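/- Let n ≥ 3 and let F be a generalized isotropic Berwald metric with data (μ, λ) on a connected open set U ⊆ ℝ^n, of scalar flag curvature with flag curvature function K(x,y), and suppose 2μ' − (μ² + 4K)F = 0 at every point, where μ' := μ_{|s} y^s. Then K is constant. -/

import Mathlib

/-!  Common setup: Finsler metrics on an open set `U ⊆ ℝⁿ`, in coordinates. -/

noncomputable section

open scoped BigOperators

/-- Points/vectors of `ℝⁿ`, as functions `Fin n → ℝ`. -/
abbrev Pt (n : ℕ) := Fin n → ℝ

variable {n : ℕ}

/-- Partial derivative in the fiber variable `y`, direction `yⁱ`. -/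
def pdy (f : Pt n → Pt n → ℝ) (i : Fin n) : Pt n → Pt n → ℝ :=
  fun x y => fderiv ℝ (fun y' => f x y') y (Pi.single i 1)

/-- Partial derivative in the base variable `x`, direction `xⁱ`. -/
def pdx (f : Pt n → Pt n → ℝ) (i : Fin n) : Pt n → Pt n → ℝ :=
  fun x y => fderiv ℝ (fun x' => f x' y) x (Pi.single i 1)

/-- `F²`. -/
def F2 (F : Pt n → Pt n → ℝ) : Pt n → Pt n → ℝ := fun x y => (F x y) ^ 2

/-- Fundamental tensor `g_{ij} = (1/2) ∂²(F²)/∂yⁱ∂yʲ`. -/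
def gLow (F : Pt n → Pt n → ℝ) (i j : Fin n) : Pt n → Pt n → ℝ :=
  fun x y => (1 / 2 : ℝ) * pdy (pdy (F2 F) j) i x y

/-- The fundamental tensor as a matrix. -/
def gMat (F : Pt n → Pt n → ℝ) (x y : Pt n) : Matrix (Fin n) (Fin n) ℝ :=
  Matrix.of fun i j => gLow F i j x y

/-- Inverse fundamental tensor `g^{ij}`. -/
def gInv (F : Pt n → Pt n → ℝ) (i j : Fin n) : Pt n → Pt n → ℝ :=
  fun x y => (gMat F x y)⁻¹ i j

/-- Lowered fiber variable `y_i := g_{ij} yʲ`. -/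
def yLow (F : Pt n → Pt n → ℝ) (i : Fin n) : Pt n → Pt n → ℝ :=
  fun x y => ∑ j, gLow F i j x y * y j

/-- `ℓⁱ := yⁱ / F`. -/
def ell (F : Pt n → Pt n → ℝ) (i : Fin n) : Pt n → Pt n → ℝ :=
  fun x y => y i / F x y

/-- Angular metric `h_{ij} := g_{ij} - F⁻² y_i y_j`. -/
def hLow (F : Pt n → Pt n → ℝ) (i j : Fin n) : Pt n → Pt n → ℝ :=
  fun x y => gLow F i j x y - yLow F i x y * yLow F j x y / (F x y) ^ 2

/-- `hⁱ_j := δⁱ_j - F⁻² yⁱ y_j`. -/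
def hUp (F : Pt n → Pt n → ℝ) (i j : Fin n) : Pt n → Pt n → ℝ :=
  fun x y => (if i = j then (1 : ℝ) else 0) - y i * yLow F j x y / (F x y) ^ 2

/-- Cartan torsion `C_{ijk} := (1/4) ∂³(F²)/∂yⁱ∂yʲ∂yᵏ`. -/
def Cartan (F : Pt n → Pt n → ℝ) (i j k : Fin n) : Pt n → Pt n → ℝ :=
  fun x y => (1 / 4 : ℝ) * pdy (pdy (pdy (F2 F) k) j) i x y

/-- Mean Cartan torsion `I_k := g^{ij} C_{ijk}`. -/
def mCartan (F : Pt n → Pt n → ℝ) (k : Fin n) : Pt n → Pt n → ℝ :=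
  fun x y => ∑ i, ∑ j, gInv F i j x y * Cartan F i j k x y

/-- Spray coefficients `Gⁱ`. -/
def Gspray (F : Pt n → Pt n → ℝ) (i : Fin n) : Pt n → Pt n → ℝ :=
  fun x y => (1 / 4 : ℝ) * ∑ l, gInv F i l x y *
    ((∑ k, y k * pdx (pdy (F2 F) l) k x y) - pdx (F2 F) l x y)

/-- Berwald curvature `Bⁱ_{jkl} := ∂³Gⁱ/∂yʲ∂yᵏ∂yˡ`. -/
def Bcurv (F : Pt n → Pt n → ℝ) (i j k l : Fin n) : Pt n → Pt n → ℝ :=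
  pdy (pdy (pdy (Gspray F i) l) k) j

/-- Mean Berwald curvature `E_{jk} := (1/2) Bᵐ_{jkm}`. -/
def Ecurv (F : Pt n → Pt n → ℝ) (j k : Fin n) : Pt n → Pt n → ℝ :=
  fun x y => (1 / 2 : ℝ) * ∑ m, Bcurv F m j k m x y

/-- Nonlinear connection `Nⁱ_j := ∂Gⁱ/∂yʲ`. -/
def Ncon (F : Pt n → Pt n → ℝ) (i j : Fin n) : Pt n → Pt n → ℝ :=
  pdy (Gspray F i) j

/-- Berwald connection coefficients `Γⁱ_{jk} := ∂²Gⁱ/∂yʲ∂yᵏ`. -/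
def Γcon (F : Pt n → Pt n → ℝ) (i j k : Fin n) : Pt n → Pt n → ℝ :=
  pdy (pdy (Gspray F i) k) j

/-- Horizontal (Berwald) covariant derivative of a scalar. -/
def hD0 (F : Pt n → Pt n → ℝ) (f : Pt n → Pt n → ℝ) (m : Fin n) : Pt n → Pt n → ℝ :=
  fun x y => pdx f m x y - ∑ r, Ncon F r m x y * pdy f r x y

/-- Horizontal covariant derivative of a covariant 2-tensor. -/
def hD2 (F : Pt n → Pt n → ℝ) (T : Fin n → Fin n → Pt n → Pt n → ℝ) (j k m : Fin n) :
    Pt n → Pt n → ℝ :=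
  fun x y => hD0 F (T j k) m x y - (∑ r, T r k x y * Γcon F r j m x y)
    - ∑ r, T j r x y * Γcon F r k m x y

/-- Horizontal covariant derivative of a covariant 3-tensor. -/
def hD3 (F : Pt n → Pt n → ℝ) (T : Fin n → Fin n → Fin n → Pt n → Pt n → ℝ) (i j k m : Fin n) :
    Pt n → Pt n → ℝ :=
  fun x y => hD0 F (T i j k) m x y - (∑ r, T r j k x y * Γcon F r i m x y)
    - (∑ r, T i r k x y * Γcon F r j m x y) - ∑ r, T i j r x y * Γcon F r k m x y

/-- Horizontal covariant derivative of a (1,3)-tensor `Tⁱ_{jkl}`. -/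
def hD13 (F : Pt n → Pt n → ℝ) (T : Fin n → Fin n → Fin n → Fin n → Pt n → Pt n → ℝ)
    (i j k l m : Fin n) : Pt n → Pt n → ℝ :=
  fun x y => hD0 F (T i j k l) m x y + (∑ r, T r j k l x y * Γcon F i r m x y)
    - (∑ r, T i r k l x y * Γcon F r j m x y) - (∑ r, T i j r l x y * Γcon F r k m x y)
    - ∑ r, T i j k r x y * Γcon F r l m x y

/-- Landsberg curvature `L_{ijk} := C_{ijk|m} yᵐ`. -/
def Land (F : Pt n → Pt n → ℝ) (i j k : Fin n) : Pt n → Pt n → ℝ :=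
  fun x y => ∑ m, hD3 F (Cartan F) i j k m x y * y m

/-- Stretch curvature `Σ_{ijkl} := 2(L_{ijk|l} - L_{ijl|k})`. -/
def Stretch (F : Pt n → Pt n → ℝ) (i j k l : Fin n) : Pt n → Pt n → ℝ :=
  fun x y => 2 * (hD3 F (Land F) i j k l x y - hD3 F (Land F) i j l k x y)

/-- Douglas tensor `Dⁱ_{jkl}`. -/
def Douglas (F : Pt n → Pt n → ℝ) (i j k l : Fin n) : Pt n → Pt n → ℝ :=
  fun x y => Bcurv F i j k l x y - (2 / ((n : ℝ) + 1)) *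
    (Ecurv F j k x y * (if i = l then (1 : ℝ) else 0)
      + Ecurv F j l x y * (if i = k then (1 : ℝ) else 0)
      + Ecurv F k l x y * (if i = j then (1 : ℝ) else 0)
      + pdy (Ecurv F j k) l x y * y i)

/-- Riemann curvature `Rⁱ_k`. -/
def RiemK (F : Pt n → Pt n → ℝ) (i k : Fin n) : Pt n → Pt n → ℝ :=
  fun x y => 2 * pdx (Gspray F i) k x y - (∑ j, y j * pdx (pdy (Gspray F i) k) j x y)
    + 2 * (∑ j, Gspray F j x y * Γcon F i j k x y) - ∑ j, Ncon F i j x y * Ncon F j k x y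

/-- `Rⁱ_{jkl} := (1/3) ∂/∂yʲ (∂Rⁱ_k/∂yˡ - ∂Rⁱ_l/∂yᵏ)`. -/
def Riem4 (F : Pt n → Pt n → ℝ) (i j k l : Fin n) : Pt n → Pt n → ℝ :=
  fun x y => (1 / 3 : ℝ) *
    pdy (fun x' y' => pdy (RiemK F i k) l x' y' - pdy (RiemK F i l) k x' y') j x y

/-- `F` is R-quadratic on `U`: `Rⁱ_{jkl}(x,y)` is independent of `y`. -/
def RQuadratic (U : Set (Pt n)) (F : Pt n → Pt n → ℝ) : Prop :=
  ∀ x ∈ U, ∀ y y' : Pt n, y ≠ 0 → y' ≠ 0 →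
    ∀ i j k l, Riem4 F i j k l x y = Riem4 F i j k l x y'

/-- A Finsler metric on a connected open set `U ⊆ ℝⁿ` (`n ≥ 2`). -/
structure IsFinslerMetric (U : Set (Pt n)) (F : Pt n → Pt n → ℝ) : Prop where
  dim : 2 ≤ n
  isOpen : IsOpen U
  connected : IsConnected U
  smooth : ContDiffOn ℝ (⊤ : ℕ∞) (Function.uncurry F) (U ×ˢ {y : Pt n | y ≠ 0})
  pos : ∀ x ∈ U, ∀ y : Pt n, y ≠ 0 → 0 < F x y
  homog : ∀ x ∈ U, ∀ y : Pt n, y ≠ 0 → ∀ t : ℝ, 0 < t → F x (t • y) = t * F x y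
  posdef : ∀ x ∈ U, ∀ y : Pt n, y ≠ 0 → (gMat F x y).PosDef

/-- `F` is a generalized isotropic Berwald metric on `U` with data `(μ, λ)`. -/
structure IsGIB (U : Set (Pt n)) (F μ lam : Pt n → Pt n → ℝ) : Prop where
  finsler : IsFinslerMetric U F
  smooth_mu : ContDiffOn ℝ (⊤ : ℕ∞) (Function.uncurry μ) (U ×ˢ {y : Pt n | y ≠ 0})
  smooth_lam : ContDiffOn ℝ (⊤ : ℕ∞) (Function.uncurry lam) (U ×ˢ {y : Pt n | y ≠ 0})
  homog_mu : ∀ x ∈ U, ∀ y : Pt n, y ≠ 0 → ∀ t : ℝ, 0 < t → μ x (t • y) = μ x y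
  homog_lam : ∀ x ∈ U, ∀ y : Pt n, y ≠ 0 → ∀ t : ℝ, 0 < t → lam x (t • y) = t⁻¹ * lam x y
  berwald : ∀ x ∈ U, ∀ y : Pt n, y ≠ 0 → ∀ i j k l,
    Bcurv F i j k l x y = μ x y * Cartan F j k l x y * ell F i x y
      + lam x y * (hUp F i j x y * hLow F k l x y + hUp F i k x y * hLow F j l x y
        + hUp F i l x y * hLow F j k x y)

end

/-- `F` is of scalar flag curvature with flag curvature function `K`. -/
def IsScalarFlagCurv {n : ℕ} (U : Set (Pt n)) (F K : Pt n → Pt n → ℝ) : Prop :=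
  ContDiffOn ℝ (⊤ : ℕ∞) (Function.uncurry K) (U ×ˢ {y : Pt n | y ≠ 0}) ∧
  ∀ x ∈ U, ∀ y : Pt n, y ≠ 0 → ∀ i k : Fin n,
    RiemK F i k x y = K x y * (F x y) ^ 2 * hUp F i k x y

noncomputable section DirectionalCalculus

variable {E V W : Type*} [NormedAddCommGroup E] [NormedSpace ℝ E]
  [NormedAddCommGroup V] [NormedSpace ℝ V] [NormedAddCommGroup W] [NormedSpace ℝ W]

/-- Smoothness on a set of the tangent space. -/
abbrev SmoothOn (Ω : Set W) (f : W → V) : Prop := ContDiffOn ℝ (⊤ : ℕ∞) f Ω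

/-- Vertical derivative of `f` in the direction of the fiber vector `w`. -/
def vD (w : E) (f : E × E → V) : E × E → V := fun p => fderiv ℝ f p (0, w)

/-- Derivative of `f` in the direction of the base vector `w`. -/
def bD (w : E) (f : E × E → V) : E × E → V := fun p => fderiv ℝ f p (w, 0)

/-- Vertical derivative of `f` along the fiber vector field `Z`. -/
def vDf (Z : E × E → E) (f : E × E → V) : E × E → V := fun p => fderiv ℝ f p (0, Z p)

/-- Derivative of `f` along the spray with coefficients `G`. -/
def sD (G : E × E → E) (f : E × E → V) : E × E → V :=
  fun p => fderiv ℝ f p (p.2, -(2 : ℝ) • G p)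

variable {Ω : Set (E × E)} {f g : E × E → V} {G Z : E × E → E}

theorem SmoothOn.differentiableAt {Ω : Set W} {f : W → V} (hΩ : IsOpen Ω) (hf : SmoothOn Ω f)
    {p : W} (hp : p ∈ Ω) : DifferentiableAt ℝ f p :=
  (hf.contDiffAt (hΩ.mem_nhds hp)).differentiableAt (by simp)

theorem SmoothOn.fderiv {Ω : Set W} {f : W → V} (hΩ : IsOpen Ω) (hf : SmoothOn Ω f) :
    SmoothOn Ω (fderiv ℝ f) :=
  ((contDiffOn_infty_iff_fderiv_of_isOpen hΩ).1 hf).2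

theorem fderiv_congr_on {Ω : Set W} {f g : W → V} (hΩ : IsOpen Ω) (h : Ω.EqOn f g)
    {p : W} (hp : p ∈ Ω) : fderiv ℝ f p = fderiv ℝ g p :=
  Filter.EventuallyEq.fderiv_eq (Filter.eventuallyEq_of_mem (hΩ.mem_nhds hp) h)

theorem fderiv_symm {Ω : Set W} {f : W → V} (hΩ : IsOpen Ω) (hf : SmoothOn Ω f) {p : W}
    (hp : p ∈ Ω) (c d : W) :
    fderiv ℝ (fderiv ℝ f) p c d = fderiv ℝ (fderiv ℝ f) p d c :=
  ((hf.contDiffAt (hΩ.mem_nhds hp)).isSymmSndFDerivAt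
    (by simpa using (WithTop.coe_le_coe.2 le_top : ((2 : ℕ∞) : WithTop ℕ∞) ≤ (⊤ : ℕ∞)))).eq c d

/-- Derivative of `q ↦ df_q(X q)`. -/
theorem fderiv_along {Ω : Set W} {f : W → V} (hΩ : IsOpen Ω) (hf : SmoothOn Ω f) {p : W}
    (hp : p ∈ Ω) {X : W → W} (hX : DifferentiableAt ℝ X p) (c : W) :
    fderiv ℝ (fun q => fderiv ℝ f q (X q)) p c =
      fderiv ℝ (fun q => fderiv ℝ f q c) p (X p) + fderiv ℝ f p (fderiv ℝ X p c) := by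
  have h1 := (hf.fderiv hΩ).differentiableAt hΩ hp
  rw [fderiv_clm_apply h1 hX, fderiv_clm_apply h1 (differentiableAt_const c)]
  simp [fderiv_symm hΩ hf hp c (X p), add_comm]

theorem SmoothOn.along {Ω : Set W} {f : W → V} (hΩ : IsOpen Ω) (hf : SmoothOn Ω f)
    {X : W → W} (hX : SmoothOn Ω X) : SmoothOn Ω (fun q => _root_.fderiv ℝ f q (X q)) :=
  (hf.fderiv hΩ).clm_apply hX

theorem SmoothOn.vD (hΩ : IsOpen Ω) (hf : SmoothOn Ω f) (w : E) : SmoothOn Ω (vD w f) :=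
  hf.along hΩ contDiffOn_const

theorem SmoothOn.bD (hΩ : IsOpen Ω) (hf : SmoothOn Ω f) (w : E) : SmoothOn Ω (bD w f) :=
  hf.along hΩ contDiffOn_const

theorem SmoothOn.vDf (hΩ : IsOpen Ω) (hf : SmoothOn Ω f) (hZ : SmoothOn Ω Z) :
    SmoothOn Ω (vDf Z f) :=
  hf.along hΩ (contDiffOn_const.prodMk hZ)

theorem vD_congr (hΩ : IsOpen Ω) (h : Ω.EqOn f g) (w : E) : Ω.EqOn (vD w f) (vD w g) :=
  fun p hp => by simp only [vD, fderiv_congr_on hΩ h hp]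

theorem bD_congr (hΩ : IsOpen Ω) (h : Ω.EqOn f g) (w : E) : Ω.EqOn (bD w f) (bD w g) :=
  fun p hp => by simp only [bD, fderiv_congr_on hΩ h hp]

theorem sD_congr (hΩ : IsOpen Ω) (h : Ω.EqOn f g) : Ω.EqOn (sD G f) (sD G g) :=
  fun p hp => by simp only [sD, fderiv_congr_on hΩ h hp]

theorem vD_add_dir (v w : E) (f : E × E → V) (p : E × E) :
    vD (v + w) f p = vD v f p + vD w f p := by
  have : ((0 : E), v + w) = (0, v) + (0, w) := by simp
  simp only [vD, this, map_add]

theorem vD_smul_dir (c : ℝ) (w : E) (f : E × E → V) (p : E × E) :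
    vD (c • w) f p = c • vD w f p := by
  have : ((0 : E), c • w) = c • (0, w) := by simp
  simp only [vD, this, map_smul]

theorem bD_add_dir (v w : E) (f : E × E → V) (p : E × E) :
    bD (v + w) f p = bD v f p + bD w f p := by
  have : (v + w, (0 : E)) = (v, 0) + (w, 0) := by simp
  simp only [bD, this, map_add]

theorem bD_smul_dir (c : ℝ) (w : E) (f : E × E → V) (p : E × E) :
    bD (c • w) f p = c • bD w f p := by
  have : (c • w, (0 : E)) = c • (w, 0) := by simp
  simp only [bD, this, map_smul]

theorem vD_sub_dir (v w : E) (f : E × E → V) (p : E × E) :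
    vD (v - w) f p = vD v f p - vD w f p := by
  have : ((0 : E), v - w) = (0, v) - (0, w) := by simp
  simp only [vD, this, map_sub]

theorem vD_zero_dir (f : E × E → V) (p : E × E) : vD 0 f p = 0 := by
  have := vD_smul_dir 0 0 f p
  simpa using this

theorem sD_eq (G : E × E → E) (f : E × E → V) (p : E × E) :
    sD G f p = bD p.2 f p - (2 : ℝ) • vD (G p) f p := by
  have : (p.2, -(2 : ℝ) • G p) = (p.2, 0) - (2 : ℝ) • (0, G p) := by simp
  simp only [sD, bD, vD, this, map_sub, map_smul]

theorem vDf_eq (Z : E × E → E) (f : E × E → V) (p : E × E) : vDf Z f p = vD (Z p) f p := rfl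

theorem vD_comm (hΩ : IsOpen Ω) (hf : SmoothOn Ω f) {p : E × E} (hp : p ∈ Ω) (v w : E) :
    vD v (vD w f) p = vD w (vD v f) p := by
  have := fderiv_along hΩ hf hp (differentiableAt_const ((0 : E), w)) (0, v)
  simp at this
  exact this

theorem vD_bD_comm (hΩ : IsOpen Ω) (hf : SmoothOn Ω f) {p : E × E} (hp : p ∈ Ω) (v w : E) :
    vD v (bD w f) p = bD w (vD v f) p := by
  have := fderiv_along hΩ hf hp (differentiableAt_const (w, (0 : E))) (0, v)
  simp at this
  exact this

theorem vD_vDf (hΩ : IsOpen Ω) (hf : SmoothOn Ω f) (hZ : SmoothOn Ω Z) {p : E × E}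
    (hp : p ∈ Ω) (v : E) :
    vD v (vDf Z f) p = vD (Z p) (vD v f) p + vD (vD v Z p) f p := by
  have hZ' := hZ.differentiableAt hΩ hp
  have := fderiv_along hΩ hf hp ((differentiableAt_const (0 : E)).prodMk hZ') (0, v)
  rw [(differentiableAt_const (0 : E)).fderiv_prodMk hZ'] at this
  simp at this
  exact this

theorem bD_vDf (hΩ : IsOpen Ω) (hf : SmoothOn Ω f) (hZ : SmoothOn Ω Z) {p : E × E}
    (hp : p ∈ Ω) (v : E) :
    bD v (vDf Z f) p = vD (Z p) (bD v f) p + vD (bD v Z p) f p := by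
  have hZ' := hZ.differentiableAt hΩ hp
  have := fderiv_along hΩ hf hp ((differentiableAt_const (0 : E)).prodMk hZ') (v, 0)
  rw [(differentiableAt_const (0 : E)).fderiv_prodMk hZ'] at this
  simp at this
  exact this

/-- Derivative along the spray of a vertical derivative. -/
theorem sD_vDf (hΩ : IsOpen Ω) (hf : SmoothOn Ω f) (hZ : SmoothOn Ω Z) {p : E × E}
    (hp : p ∈ Ω) :
    sD G (vDf Z f) p = sD G (vD (Z p) f) p + vD (sD G Z p) f p := by
  have hZ' := hZ.differentiableAt hΩ hp
  have h1 := fderiv_along hΩ hf hp ((differentiableAt_const (0 : E)).prodMk hZ')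
    (p.2, -(2 : ℝ) • G p)
  have h2 := fderiv_along hΩ hf hp (differentiableAt_const ((0 : E), Z p))
    (p.2, -(2 : ℝ) • G p)
  rw [(differentiableAt_const (0 : E)).fderiv_prodMk hZ'] at h1
  simp only [fderiv_fun_const, Pi.zero_apply, zero_apply, map_zero,
    add_zero, ContinuousLinearMap.prod_apply] at h1 h2
  exact h1.trans (congrArg (· + _) h2.symm)

/-- The commutator of a vertical derivative with the spray. -/
theorem vD_sD (hΩ : IsOpen Ω) (hf : SmoothOn Ω f) (hG : SmoothOn Ω G) {p : E × E}
    (hp : p ∈ Ω) (v : E) :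
    vD v (sD G f) p = sD G (vD v f) p + bD v f p - (2 : ℝ) • vD (vD v G p) f p := by
  have hG' := hG.differentiableAt hΩ hp
  have h1 := fderiv_along hΩ hf hp
    ((differentiableAt_snd (p := p)).prodMk (hG'.const_smul (-(2 : ℝ)))) (0, v)
  rw [(differentiableAt_snd (p := p)).fderiv_prodMk (hG'.const_smul (-(2 : ℝ))),
    fderiv_const_smul hG'] at h1
  have h2 : (v, -(2 : ℝ) • fderiv ℝ G p (0, v)) =
      (v, 0) - (2 : ℝ) • ((0 : E), fderiv ℝ G p (0, v)) := by simp
  simp only [ContinuousLinearMap.prod_apply, fderiv_snd, ContinuousLinearMap.coe_snd',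
    smul_apply, h2, map_sub, map_smul] at h1
  rw [← add_sub_assoc] at h1
  exact h1

theorem vD_add (hΩ : IsOpen Ω) (hf : SmoothOn Ω f) (hg : SmoothOn Ω g) {p : E × E}
    (hp : p ∈ Ω) (v : E) : vD v (fun q => f q + g q) p = vD v f p + vD v g p := by
  simp [vD, fderiv_fun_add (hf.differentiableAt hΩ hp) (hg.differentiableAt hΩ hp)]

theorem vD_sub (hΩ : IsOpen Ω) (hf : SmoothOn Ω f) (hg : SmoothOn Ω g) {p : E × E}
    (hp : p ∈ Ω) (v : E) : vD v (fun q => f q - g q) p = vD v f p - vD v g p := by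
  simp [vD, fderiv_fun_sub (hf.differentiableAt hΩ hp) (hg.differentiableAt hΩ hp)]

theorem vD_const_smul (hΩ : IsOpen Ω) (hf : SmoothOn Ω f) {p : E × E}
    (hp : p ∈ Ω) (v : E) (c : ℝ) : vD v (fun q => c • f q) p = c • vD v f p := by
  simp [vD, fderiv_fun_const_smul (hf.differentiableAt hΩ hp)]

variable {φ ψ : E × E → ℝ}

theorem vD_mul (hΩ : IsOpen Ω) (hφ : SmoothOn Ω φ) (hψ : SmoothOn Ω ψ) {p : E × E}
    (hp : p ∈ Ω) (v : E) :
    vD v (fun q => φ q * ψ q) p = vD v φ p * ψ p + φ p * vD v ψ p := by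
  simp [vD, fderiv_fun_mul (hφ.differentiableAt hΩ hp) (hψ.differentiableAt hΩ hp)]
  ring

theorem sD_mul (hΩ : IsOpen Ω) (hφ : SmoothOn Ω φ) (hψ : SmoothOn Ω ψ) {p : E × E}
    (hp : p ∈ Ω) :
    sD G (fun q => φ q * ψ q) p = sD G φ p * ψ p + φ p * sD G ψ p := by
  simp [sD, fderiv_fun_mul (hφ.differentiableAt hΩ hp) (hψ.differentiableAt hΩ hp)]
  ring

theorem vD_smul_add_smul_snd (hΩ : IsOpen Ω) (hφ : SmoothOn Ω φ) (hψ : SmoothOn Ω ψ)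
    {p : E × E} (hp : p ∈ Ω) (v c : E) :
    vD v (fun q => φ q • c + ψ q • q.2) p =
      vD v φ p • c + (vD v ψ p • p.2 + ψ p • v) := by
  have h1 := hφ.differentiableAt hΩ hp
  have h2 := hψ.differentiableAt hΩ hp
  simp only [vD]
  rw [fderiv_fun_add (h1.smul_const c) (h2.fun_smul differentiableAt_snd),
    fderiv_smul_const h1, fderiv_fun_smul h2 differentiableAt_snd]
  simp [fderiv_snd, add_comm]

end DirectionalCalculus

noncomputable section SprayGeometry

variable {E : Type*} [NormedAddCommGroup E] [NormedSpace ℝ E]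
  {Ω : Set (E × E)} {L K : E × E → ℝ} {G : E × E → E}

theorem vD_snd (v : E) (p : E × E) : vD v (Prod.snd : E × E → E) p = v := by
  simp [vD, fderiv_snd]

theorem bD_snd (v : E) (p : E × E) : bD v (Prod.snd : E × E → E) p = 0 := by
  simp [bD, fderiv_snd]

theorem euler_vD {k : ℝ} (hΩ : IsOpen Ω) (hL : SmoothOn Ω L)
    (euler : ∀ p ∈ Ω, vD p.2 L p = k * L p) {p : E × E} (hp : p ∈ Ω) (w : E) :
    vD p.2 (vD w L) p = (k - 1) * vD w L p := by
  have h1 : Ω.EqOn (vDf Prod.snd L) (fun q => k • L q) := fun q hq => euler q hq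
  have h2 := vD_congr hΩ h1 w hp
  rw [vD_vDf hΩ hL contDiffOn_snd hp, vD_snd, vD_const_smul hΩ hL hp, smul_eq_mul] at h2
  linear_combination h2

theorem euler_bD {k : ℝ} (hΩ : IsOpen Ω) (hL : SmoothOn Ω L)
    (euler : ∀ p ∈ Ω, vD p.2 L p = k * L p) {p : E × E} (hp : p ∈ Ω) (w : E) :
    vD p.2 (bD w L) p = k * bD w L p := by
  have h1 : Ω.EqOn (vDf Prod.snd L) (fun q => k • L q) := fun q hq => euler q hq
  have h2 := bD_congr hΩ h1 w hp
  rw [bD_vDf hΩ hL contDiffOn_snd hp, bD_snd, vD_zero_dir, add_zero] at h2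
  rw [h2]
  simp only [bD]
  rw [fderiv_fun_const_smul (hL.differentiableAt hΩ hp)]
  simp

/-- The spray annihilates the energy. -/
theorem sD_energy (hΩ : IsOpen Ω) (hL : SmoothOn Ω L)
    (euler : ∀ p ∈ Ω, vD p.2 L p = 2 * L p)
    (hEL : ∀ w, ∀ p ∈ Ω, sD G (vD w L) p = bD w L p) {p : E × E} (hp : p ∈ Ω) :
    sD G L p = 0 := by
  have h1 := hEL p.2 p hp
  rw [sD_eq, ← vD_bD_comm hΩ hL hp, euler_bD hΩ hL euler hp, vD_comm hΩ hL hp,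
    euler_vD hΩ hL euler hp] at h1
  rw [sD_eq]
  simp only [smul_eq_mul] at *
  linear_combination h1

/-- The energy is horizontally constant. -/
theorem bD_energy (hΩ : IsOpen Ω) (hL : SmoothOn Ω L) (hG : SmoothOn Ω G)
    (euler : ∀ p ∈ Ω, vD p.2 L p = 2 * L p)
    (hEL : ∀ w, ∀ p ∈ Ω, sD G (vD w L) p = bD w L p) {p : E × E} (hp : p ∈ Ω) (v : E) :
    bD v L p = vD (vD v G p) L p := by
  have h1 : Ω.EqOn (sD G L) (fun _ => 0) := fun q hq => sD_energy hΩ hL euler hEL hq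
  have h2 := vD_congr hΩ h1 v hp
  rw [vD_sD hΩ hL hG hp, hEL v p hp] at h2
  simp only [vD, fderiv_fun_const, Pi.zero_apply, zero_apply, smul_eq_mul] at h2 ⊢
  linear_combination (1 / 2) * h2

/-- The spray coefficients are homogeneous of degree two. -/
theorem euler_spray (hΩ : IsOpen Ω) (hL : SmoothOn Ω L) (hG : SmoothOn Ω G)
    (euler : ∀ p ∈ Ω, vD p.2 L p = 2 * L p)
    (hEL : ∀ w, ∀ p ∈ Ω, sD G (vD w L) p = bD w L p) {p : E × E} (hp : p ∈ Ω)
    (nondeg : ∀ u, (∀ w, vD u (vD w L) p = 0) → u = 0) :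
    vD p.2 G p = (2 : ℝ) • G p := by
  refine sub_eq_zero.1 (nondeg _ fun w => ?_)
  have hw := hL.vD hΩ w
  have eulerw : ∀ p ∈ Ω, vD p.2 (vD w L) p = 1 * vD w L p := fun q hq => by
    rw [euler_vD hΩ hL euler hq]; ring
  have h1 := vD_congr hΩ (fun q hq => hEL w q hq) p.2 hp
  rw [vD_sD hΩ hw hG hp, euler_bD hΩ hL euler hp, sD_eq, ← vD_bD_comm hΩ hw hp,
    euler_bD hΩ hw eulerw hp, vD_comm hΩ hw hp, euler_vD hΩ hw eulerw hp] at h1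
  have h2 := hEL w p hp
  rw [sD_eq] at h2
  rw [vD_sub_dir, vD_smul_dir]
  simp only [smul_eq_mul] at *
  linear_combination h2 - (1 / 2) * h1

theorem sD_hessian (hΩ : IsOpen Ω) (hL : SmoothOn Ω L) (hG : SmoothOn Ω G)
    (euler : ∀ p ∈ Ω, vD p.2 L p = 2 * L p)
    (hEL : ∀ w, ∀ p ∈ Ω, sD G (vD w L) p = bD w L p) {p : E × E} (hp : p ∈ Ω) (v : E) :
    sD G (vD v (vD v L)) p = 2 * vD (vD v G p) (vD v L) p := by
  have h1 : Ω.EqOn (bD v L) (vDf (vD v G) L) := fun q hq => bD_energy hΩ hL hG euler hEL hq v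
  have h2 := (vD_bD_comm hΩ hL hp v v).symm.trans (vD_congr hΩ h1 v hp)
  have h3 := vD_congr hΩ (fun q hq => hEL v q hq) v hp
  rw [vD_sD hΩ (hL.vD hΩ v) hG hp, vD_bD_comm hΩ hL hp] at h3
  simp only [smul_eq_mul] at *
  linear_combination h3

/-- Derivative of the Cartan torsion along the spray. -/
theorem sD_third (hΩ : IsOpen Ω) (hL : SmoothOn Ω L) (hG : SmoothOn Ω G)
    (euler : ∀ p ∈ Ω, vD p.2 L p = 2 * L p)
    (hEL : ∀ w, ∀ p ∈ Ω, sD G (vD w L) p = bD w L p) {p : E × E} (hp : p ∈ Ω) (v : E) :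
    sD G (vD v (vD v (vD v L))) p =
      3 * vD (vD v G p) (vD v (vD v L)) p - vD (vD v (vD v (vD v G)) p) L p := by
  have hN := hG.vD hΩ v
  have hΓ := hN.vD hΩ v
  have hLv := hL.vD hΩ v
  have h1 : Ω.EqOn (bD v L) (vDf (vD v G) L) := fun q hq => bD_energy hΩ hL hG euler hEL hq v
  have h2 : Ω.EqOn (bD v (vD v L))
      (fun q => vDf (vD v G) (vD v L) q + vDf (vD v (vD v G)) L q) := fun q hq => by
    rw [← vD_bD_comm hΩ hL hq, vD_congr hΩ h1 v hq, vD_vDf hΩ hL hN hq]; rfl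
  have h3 := (vD_bD_comm hΩ hLv hp v v).symm.trans (vD_congr hΩ h2 v hp)
  rw [vD_add hΩ (hLv.vDf hΩ hN) (hL.vDf hΩ hΓ) hp, vD_vDf hΩ hLv hN hp,
    vD_vDf hΩ hL hΓ hp] at h3
  have h4 : Ω.EqOn (sD G (vD v (vD v L))) (fun q => (2 : ℝ) • vDf (vD v G) (vD v L) q) :=
    fun q hq => sD_hessian hΩ hL hG euler hEL hq v
  have h5 := vD_congr hΩ h4 v hp
  rw [vD_const_smul hΩ (hLv.vDf hΩ hN) hp, vD_vDf hΩ hLv hN hp,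
    vD_sD hΩ (hLv.vD hΩ v) hG hp] at h5
  simp only [smul_eq_mul] at *
  linear_combination h5 - h3

/-- Derivative of the Berwald curvature along the spray. -/
theorem sD_berwald (hΩ : IsOpen Ω) (hG : SmoothOn Ω G) {R : E × E → E} (hR : SmoothOn Ω R)
    (v : E) (hRiem : ∀ p ∈ Ω,
      sD G (vD v G) p = (2 : ℝ) • bD v G p - vDf (vD v G) G p - R p) {p : E × E} (hp : p ∈ Ω) :
    sD G (vD v (vD v (vD v G))) p = (3 : ℝ) • vD (vD v G p) (vD v (vD v G)) p
      - vD (vD v (vD v (vD v G)) p) G p - vD v (vD v R) p := by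
  have hN := hG.vD hΩ v
  have hΓ := hN.vD hΩ v
  have hB := hΓ.vD hΩ v
  have h1 : ∀ q ∈ Ω, sD G (vD v (vD v G)) q =
      bD v (vD v G) q + vDf (vD v G) (vD v G) q - vDf (vD v (vD v G)) G q - vD v R q := by
    intro q hq
    have h := vD_congr hΩ (fun q hq => hRiem q hq) v hq
    rw [vD_sD hΩ hN hG hq, vD_sub hΩ (((hG.bD hΩ v).const_smul _).sub (hG.vDf hΩ hN)) hR hq,
      vD_sub hΩ ((hG.bD hΩ v).const_smul _) (hG.vDf hΩ hN) hq,
      vD_const_smul hΩ (hG.bD hΩ v) hq, vD_bD_comm hΩ hG hq, vD_vDf hΩ hG hN hq] at h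
    simp only [vDf_eq]
    linear_combination (norm := module) h
  have h := vD_congr hΩ (fun q hq => h1 q hq) v hp
  rw [vD_sD hΩ hΓ hG hp,
    vD_sub hΩ (((hN.bD hΩ v).add (hN.vDf hΩ hN)).sub (hG.vDf hΩ hΓ)) (hR.vD hΩ v) hp,
    vD_sub hΩ ((hN.bD hΩ v).add (hN.vDf hΩ hN)) (hG.vDf hΩ hΓ) hp,
    vD_add hΩ (hN.bD hΩ v) (hN.vDf hΩ hN) hp, vD_bD_comm hΩ hN hp,
    vD_vDf hΩ hN hN hp, vD_vDf hΩ hG hΓ hp] at h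
  linear_combination (norm := module) h

/-- Derivative along the spray of the Berwald curvature paired with the energy covector. -/
theorem sD_landsberg (hΩ : IsOpen Ω) (hL : SmoothOn Ω L) (hG : SmoothOn Ω G)
    (euler : ∀ p ∈ Ω, vD p.2 L p = 2 * L p)
    (hEL : ∀ w, ∀ p ∈ Ω, sD G (vD w L) p = bD w L p)
    {R : E × E → E} (hR : SmoothOn Ω R) (v : E) (hRiem : ∀ p ∈ Ω,
      sD G (vD v G) p = (2 : ℝ) • bD v G p - vDf (vD v G) G p - R p) {p : E × E} (hp : p ∈ Ω) :
    sD G (vDf (vD v (vD v (vD v G))) L) p =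
      3 * vD (vD (vD v G p) (vD v (vD v G)) p) L p - vD (vD v (vD v R) p) L p := by
  have hB := ((hG.vD hΩ v).vD hΩ v).vD hΩ v
  rw [sD_vDf hΩ hL hB hp, hEL _ p hp, bD_energy hΩ hL hG euler hEL hp,
    sD_berwald hΩ hG hR v hRiem hp, vD_sub_dir, vD_sub_dir, vD_smul_dir, smul_eq_mul]
  ring

/-- The Riemann curvature of scalar flag curvature `K`, in the direction `v`; here `L = F²`. -/
def scalarCurv (L K : E × E → ℝ) (v : E) : E × E → E :=
  fun p => (K p * L p) • v + (-(1 / 2) * (K p * vD v L p)) • p.2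

theorem SmoothOn.scalarCurv (hΩ : IsOpen Ω) (hL : SmoothOn Ω L) (hK : SmoothOn Ω K) (v : E) :
    SmoothOn Ω (scalarCurv L K v) :=
  ((hK.mul hL).smul contDiffOn_const).add
    ((contDiffOn_const.mul (hK.mul (hL.vD hΩ v))).smul contDiffOn_snd)

theorem vD_vD_scalarCurv (hΩ : IsOpen Ω) (hL : SmoothOn Ω L) (hK : SmoothOn Ω K)
    (euler : ∀ p ∈ Ω, vD p.2 L p = 2 * L p) {p : E × E} (hp : p ∈ Ω) (v : E) :
    vD (vD v (vD v (scalarCurv L K v)) p) L p =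
      vD v K p * ((vD v L p) ^ 2 - 2 * (L p * vD v (vD v L) p))
        - K p * L p * vD v (vD v (vD v L)) p := by
  have hLv := hL.vD hΩ v
  have hLvv := hLv.vD hΩ v
  have hKv := hK.vD hΩ v
  have hKL := hK.mul hL
  have hKLv := hK.mul hLv
  have hψ : SmoothOn Ω (fun q => -(1 / 2) * (K q * vD v L q)) := contDiffOn_const.mul hKLv
  have hφ1 : Ω.EqOn (vD v (fun q => K q * L q)) (fun q => vD v K q * L q + K q * vD v L q) :=
    fun q hq => vD_mul hΩ hK hL hq v
  have hψ1 : Ω.EqOn (vD v (fun q => -(1 / 2) * (K q * vD v L q)))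
      (fun q => (-(1 / 2) : ℝ) • (vD v K q * vD v L q + K q * vD v (vD v L) q)) :=
    fun q hq => (vD_const_smul hΩ hKLv hq v (-(1 / 2))).trans
      (congrArg _ (vD_mul hΩ hK hLv hq v))
  have h1 : Ω.EqOn (vD v (scalarCurv L K v))
      (fun q => (vD v K q * L q + K q * vD v L q + -(1 / 2) * (K q * vD v L q)) • v +
        ((-(1 / 2) : ℝ) • (vD v K q * vD v L q + K q * vD v (vD v L) q)) • q.2) := by
    intro q hq
    have h := vD_smul_add_smul_snd hΩ hKL hψ hq v v
    rw [hφ1 hq, hψ1 hq] at h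
    refine Eq.trans h ?_
    module
  have hA := hKv.mul hL
  have hB := hKv.mul hLv
  have hC := hK.mul hLvv
  rw [vD_congr hΩ h1 v hp, vD_smul_add_smul_snd hΩ ((hA.add hKLv).add hψ)
    ((hB.add hC).const_smul _) hp, vD_add hΩ (hA.add hKLv) hψ hp, vD_add hΩ hA hKLv hp, hψ1 hp,
    vD_const_smul hΩ (hB.add hC) hp, vD_add hΩ hB hC hp, vD_mul hΩ hKv hL hp,
    vD_mul hΩ hK hLv hp, vD_mul hΩ hKv hLv hp, vD_mul hΩ hK hLvv hp]
  simp only [vD_add_dir, vD_smul_dir, smul_eq_mul, euler p hp]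
  ring

/-- Under the curvature equation `2 m' = m² + 4 K L` for `m = μ F`, the flag curvature has
vanishing vertical derivative wherever the angular metric does not degenerate. -/
theorem vD_flagCurv_mul_eq_zero (hΩ : IsOpen Ω) (hL : SmoothOn Ω L) (hG : SmoothOn Ω G)
    (hK : SmoothOn Ω K) {m : E × E → ℝ} (hm : SmoothOn Ω m)
    (euler : ∀ p ∈ Ω, vD p.2 L p = 2 * L p)
    (hEL : ∀ w, ∀ p ∈ Ω, sD G (vD w L) p = bD w L p)
    (hRiem : ∀ v, ∀ p ∈ Ω,
      sD G (vD v G) p = (2 : ℝ) • bD v G p - vDf (vD v G) G p - scalarCurv L K v p)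
    (hBer : ∀ u v, ∀ p ∈ Ω, vD (vD u (vD v (vD v G)) p) L p =
      (1 / 2) * (m p * vD u (vD v (vD v L)) p))
    (hm' : ∀ p ∈ Ω, 2 * sD G m p = m p ^ 2 + 4 * (K p * L p)) {p : E × E} (hp : p ∈ Ω) (v : E) :
    vD v K p * ((vD v L p) ^ 2 - 2 * (L p * vD v (vD v L) p)) = 0 := by
  have hLvvv := ((hL.vD hΩ v).vD hΩ v).vD hΩ v
  have h1 := sD_landsberg hΩ hL hG euler hEL (hL.scalarCurv hΩ hK v) v (hRiem v) hp
  have hhalf : SmoothOn Ω (fun q => (1 / 2 : ℝ) * m q) := contDiffOn_const.mul hm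
  have h2 : Ω.EqOn (vDf (vD v (vD v (vD v G))) L)
      (fun q => ((1 / 2 : ℝ) * m q) * vD v (vD v (vD v L)) q) := fun q hq =>
    (hBer v v q hq).trans (mul_assoc _ _ _).symm
  have h3 : sD G (fun q => (1 / 2 : ℝ) * m q) p = (1 / 2) * sD G m p := by
    simp [sD, fderiv_const_mul (hm.differentiableAt hΩ hp)]
  rw [sD_congr hΩ h2 hp, sD_mul hΩ hhalf hLvvv hp, h3, sD_third hΩ hL hG euler hEL hp,
    hBer _ _ p hp,
    hBer _ _ p hp, vD_vD_scalarCurv hΩ hL hK euler hp] at h1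
  linear_combination h1 - (1 / 4) * vD v (vD v (vD v L)) p * hm' p hp

/-- If `K` has no vertical derivative transversally to the position vector, it has none at all. -/
theorem vD_flagCurv_eq_zero {p : E × E} (hpos : 0 < L p)
    (hsymm : ∀ v w, vD v (vD w L) p = vD w (vD v L) p)
    (euler : vD p.2 L p = 2 * L p) (euler' : ∀ w, vD p.2 (vD w L) p = vD w L p)
    (hlin : ∀ (u v : E) (c : ℝ) (w : E), vD u (vD (v + c • w) L) p =
      vD u (vD v L) p + c * vD u (vD w L) p)
    (hdef : ∀ v, v ≠ 0 → 0 < vD v (vD v L) p) (hdim : ∃ u : E, ∀ c : ℝ, u ≠ c • p.2)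
    (h : ∀ v, vD v K p * ((vD v L p) ^ 2 - 2 * (L p * vD v (vD v L) p)) = 0) (v : E) :
    vD v K p = 0 := by
  have key : ∀ v : E, (∀ c : ℝ, v ≠ c • p.2) → vD v K p = 0 := by
    intro v hv
    refine (mul_eq_zero.1 (h v)).resolve_right (ne_of_lt ?_)
    set c : ℝ := -(vD v L p / (2 * L p)) with hc
    have hne : v + c • p.2 ≠ 0 := fun h0 =>
      hv (-c) (by rw [neg_smul]; exact eq_neg_of_add_eq_zero_left h0)
    have hpos' := hdef _ hne
    rw [hlin, vD_add_dir, vD_smul_dir, vD_add_dir, vD_smul_dir, hsymm v p.2, euler' v, euler' p.2,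
      euler] at hpos'
    have hcL : c * (2 * L p) = -vD v L p := by rw [hc]; field_simp
    simp only [smul_eq_mul] at hpos'
    have : 0 < 2 * L p * (vD v (vD v L) p + c * vD v L p + c * (vD v L p + c * (2 * L p))) :=
      mul_pos (by positivity) hpos'
    rw [hcL] at this
    linear_combination this + vD v L p * hcL
  by_cases hv : ∀ c : ℝ, v ≠ c • p.2
  · exact key v hv
  · push Not at hv
    obtain ⟨c, rfl⟩ := hv
    obtain ⟨u, hu⟩ := hdim
    have h1 := key (c • p.2 + u) fun d hd => hu (d - c) (by rw [sub_smul, ← hd]; simp)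
    rwa [vD_add_dir, key u hu, add_zero] at h1

/-- Horizontal derivative of `f` in the direction `v`. -/
def hD {V : Type*} [NormedAddCommGroup V] [NormedSpace ℝ V] (G : E × E → E) (v : E)
    (f : E × E → V) : E × E → V := fun p => fderiv ℝ f p (v, -vD v G p)

theorem hD_eq {V : Type*} [NormedAddCommGroup V] [NormedSpace ℝ V] (G : E × E → E) (v : E)
    (f : E × E → V) (p : E × E) : hD G v f p = bD v f p - vD (vD v G p) f p := by
  have : (v, -vD v G p) = (v, 0) - (0, vD v G p) := by simp
  simp only [hD, this, map_sub]
  rfl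

theorem hD_smul_add_smul {φ ψ : E × E → ℝ} (hΩ : IsOpen Ω) (hφ : SmoothOn Ω φ)
    (hψ : SmoothOn Ω ψ) {p : E × E} (hp : p ∈ Ω) (c a b : E) :
    hD G c (fun q => φ q • a + ψ q • b) p = hD G c φ p • a + hD G c ψ p • b := by
  have h1 := hφ.differentiableAt hΩ hp
  have h2 := hψ.differentiableAt hΩ hp
  simp only [hD]
  rw [fderiv_fun_add (h1.smul_const a) (h2.smul_const b), fderiv_smul_const h1,
    fderiv_smul_const h2]
  simp

/-- The curvature of the nonlinear connection when the flag curvature is isotropic. -/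
theorem hD_curvature (hΩ : IsOpen Ω) (hL : SmoothOn Ω L) (hG : SmoothOn Ω G)
    (hK : SmoothOn Ω K) (hRiem : ∀ v, ∀ p ∈ Ω,
      sD G (vD v G) p = (2 : ℝ) • bD v G p - vDf (vD v G) G p - scalarCurv L K v p)
    (hKv : ∀ p ∈ Ω, ∀ v, vD v K p = 0) {p : E × E} (hp : p ∈ Ω) (a b : E) :
    hD G b (vD a G) p - hD G a (vD b G) p =
      ((1 / 2) * (K p * vD a L p)) • b + (-(1 / 2) * (K p * vD b L p)) • a := by
  have key : ∀ a b : E, sD G (vD b (vD a G)) p + bD b (vD a G) p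
      - (2 : ℝ) • vD (vD b G p) (vD a G) p =
      (2 : ℝ) • bD a (vD b G) p - vD (vD a G p) (vD b G) p - vD (vD b (vD a G) p) G p
      - ((K p * vD b L p) • a + ((-(1 / 2) * (K p * vD b (vD a L) p)) • p.2 +
        (-(1 / 2) * (K p * vD a L p)) • b)) := by
    intro a b
    have hN := hG.vD hΩ a
    have hLa := hL.vD hΩ a
    have hψ : SmoothOn Ω (fun q => -(1 / 2) * (K q * vD a L q)) :=
      contDiffOn_const.mul (hK.mul hLa)
    have h := vD_congr hΩ (fun q hq => hRiem a q hq) b hp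
    rw [vD_sD hΩ hN hG hp, vD_sub hΩ (((hG.bD hΩ a).const_smul _).sub (hG.vDf hΩ hN))
      (hL.scalarCurv hΩ hK a) hp, vD_sub hΩ ((hG.bD hΩ a).const_smul _) (hG.vDf hΩ hN) hp,
      vD_const_smul hΩ (hG.bD hΩ a) hp, vD_bD_comm hΩ hG hp, vD_vDf hΩ hG hN hp] at h
    have h2 : vD b (scalarCurv L K a) p = _ := vD_smul_add_smul_snd hΩ (hK.mul hL) hψ hp b a
    have h3 := vD_const_smul hΩ (hK.mul hLa) hp b (-(1 / 2))
    simp only [smul_eq_mul] at h3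
    rw [h3, vD_mul hΩ hK hL hp, vD_mul hΩ hK hLa hp, hKv p hp] at h2
    simp only [zero_mul, zero_add] at h2
    rw [h, h2]
    abel
  have h1 := key a b
  have h2 := key b a
  have h3 := sD_congr (G := G) hΩ (fun q hq => vD_comm hΩ hG hq b a) hp
  rw [vD_comm hΩ hL hp b a, vD_comm hΩ hG hp b a, h3] at h1
  rw [hD_eq, hD_eq]
  linear_combination (norm := module) (1 / 3 : ℝ) • h1 - (1 / 3 : ℝ) • h2

/-- The horizontal lift of a base vector. -/
def horLift (G : E × E → E) (v : E) : E × E → E × E := fun p => (v, -vD v G p)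

theorem SmoothOn.horLift (hΩ : IsOpen Ω) (hG : SmoothOn Ω G) (v : E) :
    SmoothOn Ω (horLift G v) :=
  contDiffOn_const.prodMk (hG.vD hΩ v).neg

open VectorField in
theorem lieBracket_horLift_vertical (hΩ : IsOpen Ω) (hG : SmoothOn Ω G) {T : E × E → E}
    (hT : SmoothOn Ω T) {p : E × E} (hp : p ∈ Ω) (c : E) :
    lieBracket ℝ (horLift G c) (fun q => (0, T q)) p =
      (0, hD G c T p + vD (T p) (vD c G) p) := by
  have h1 := hT.differentiableAt hΩ hp
  have h2 := (hG.vD hΩ c).differentiableAt hΩ hp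
  rw [lieBracket_eq]
  unfold horLift
  beta_reduce
  rw [(differentiableAt_const (0 : E)).fderiv_prodMk h1,
    (differentiableAt_const c).fderiv_prodMk h2.fun_neg, fderiv_fun_neg]
  simp [hD, vD]

open VectorField in
theorem lieBracket_horLift (hΩ : IsOpen Ω) (hG : SmoothOn Ω G) {p : E × E} (hp : p ∈ Ω)
    (a b : E) :
    lieBracket ℝ (horLift G a) (horLift G b) p =
      (0, hD G b (vD a G) p - hD G a (vD b G) p) := by
  have h1 := (hG.vD hΩ a).differentiableAt hΩ hp
  have h2 := (hG.vD hΩ b).differentiableAt hΩ hp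
  rw [lieBracket_eq]
  unfold horLift
  beta_reduce
  rw [(differentiableAt_const a).fderiv_prodMk h1.fun_neg,
    (differentiableAt_const b).fderiv_prodMk h2.fun_neg, fderiv_fun_neg, fderiv_fun_neg]
  simp [hD]
  abel

open VectorField in
/-- The second Bianchi identity for isotropic flag curvature. -/
theorem bianchi_isotropic [CompleteSpace E] (hΩ : IsOpen Ω) (hL : SmoothOn Ω L)
    (hG : SmoothOn Ω G) (hK : SmoothOn Ω K)
    (hhor : ∀ v, ∀ p ∈ Ω, bD v L p = vD (vD v G p) L p)
    (hRiem : ∀ v, ∀ p ∈ Ω,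
      sD G (vD v G) p = (2 : ℝ) • bD v G p - vDf (vD v G) G p - scalarCurv L K v p)
    (hKv : ∀ p ∈ Ω, ∀ v, vD v K p = 0) {p : E × E} (hp : p ∈ Ω) (a b c : E) :
    bD a K p • (vD b L p • c - vD c L p • b) + bD b K p • (vD c L p • a - vD a L p • c)
      + bD c K p • (vD a L p • b - vD b L p • a) = 0 := by
  have hφ : ∀ (r : ℝ) (a : E), SmoothOn Ω (fun q => r * (K q * vD a L q)) := fun r a =>
    contDiffOn_const.mul (hK.mul (hL.vD hΩ a))
  have hhD : ∀ (r : ℝ) (a c : E), hD G c (fun q => r * (K q * vD a L q)) p =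
      r * (bD c K p * vD a L p + K p * vD (vD a (vD c G) p) L p) := by
    intro r a c
    have hLa := hL.vD hΩ a
    have h1 : Ω.EqOn (bD c L) (vDf (vD c G) L) := fun q hq => hhor c q hq
    have h2 := vD_congr hΩ h1 a hp
    rw [vD_bD_comm hΩ hL hp, vD_vDf hΩ hL (hG.vD hΩ c) hp] at h2
    have h3 : hD G c (vD a L) p = vD (vD a (vD c G) p) L p := by
      rw [hD_eq]; linear_combination h2
    have h4 : hD G c K p = bD c K p := by rw [hD_eq, hKv p hp, sub_zero]
    have hd1 := hK.differentiableAt hΩ hp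
    have hd2 := hLa.differentiableAt hΩ hp
    rw [← h3, ← h4]
    simp only [hD]
    rw [fderiv_const_mul (hd1.fun_mul hd2), fderiv_fun_mul hd1 hd2]
    simp
    ring
  have key : ∀ a b c : E, lieBracket ℝ (horLift G c) (lieBracket ℝ (horLift G a) (horLift G b)) p =
      (0, (1 / 2 : ℝ) • ((bD c K p * vD a L p + K p * vD (vD a (vD c G) p) L p) • b
        - (bD c K p * vD b L p + K p * vD (vD b (vD c G) p) L p) • a
        + (K p * vD a L p) • vD b (vD c G) p - (K p * vD b L p) • vD a (vD c G) p)) := by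
    intro a b c
    have hT : SmoothOn Ω (fun q => ((1 / 2) * (K q * vD a L q)) • b +
        (-(1 / 2) * (K q * vD b L q)) • a) :=
      ((hφ _ a).smul contDiffOn_const).add ((hφ _ b).smul contDiffOn_const)
    have h1 : lieBracket ℝ (horLift G a) (horLift G b) =ᶠ[nhds p] fun q =>
        ((0 : E), ((1 / 2) * (K q * vD a L q)) • b + (-(1 / 2) * (K q * vD b L q)) • a) :=
      Filter.eventuallyEq_of_mem (hΩ.mem_nhds hp) fun q hq => by
        rw [lieBracket_horLift hΩ hG hq, hD_curvature hΩ hL hG hK hRiem hKv hq]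
    rw [Filter.EventuallyEq.lieBracket_vectorField_eq Filter.EventuallyEq.rfl h1,
      lieBracket_horLift_vertical hΩ hG hT hp, hD_smul_add_smul hΩ (hφ _ a) (hφ _ b) hp,
      hhD, hhD, vD_add_dir, vD_smul_dir, vD_smul_dir]
    congr 1
    module
  have hX : ∀ v, ContDiffAt ℝ (⊤ : ℕ∞) (horLift G v) p := fun v =>
    (SmoothOn.horLift hΩ hG v).contDiffAt (hΩ.mem_nhds hp)
  have jac := leibniz_identity_lieBracket (𝕜 := ℝ)
    (by simpa using (WithTop.coe_le_coe.2 le_top : ((2 : ℕ∞) : WithTop ℕ∞) ≤ (⊤ : ℕ∞)))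
    (hX a) (hX b) (hX c)
  rw [lieBracket_swap (V := lieBracket ℝ (horLift G a) (horLift G b)),
    key, key, key] at jac
  have jac2 := congrArg Prod.snd jac
  simp only [Prod.snd_add, Prod.snd_neg] at jac2
  rw [vD_comm hΩ hG hp b a, vD_comm hΩ hG hp c a, vD_comm hΩ hG hp c b] at jac2
  linear_combination (norm := module) (2 : ℝ) • jac2

end SprayGeometry

noncomputable section Coordinates

variable {n : ℕ} {V : Type*} [NormedAddCommGroup V] [NormedSpace ℝ V]

theorem eq_of_isLinearMap_of_single {A B : Pt n → V} (hA : IsLinearMap ℝ A)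
    (hB : IsLinearMap ℝ B) (h : ∀ i, A (Pi.single i 1) = B (Pi.single i 1)) (v : Pt n) :
    A v = B v := by
  have : hA.mk' A = hB.mk' B := LinearMap.pi_ext' fun i => LinearMap.ext_ring (h i)
  exact LinearMap.congr_fun this v

theorem isLinearMap_eq_sum {A : Pt n → V} (hA : IsLinearMap ℝ A) (v : Pt n) :
    A v = ∑ i, v i • A (Pi.single i 1) := by
  have := congrArg (hA.mk' A) (pi_eq_sum_univ' v)
  simpa only [map_sum, map_smul, IsLinearMap.mk'_apply] using this

variable {E : Type*} [NormedAddCommGroup E] [NormedSpace ℝ E] {Ω : Set (E × E)} {f : E × E → V}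
  {G : E × E → E}

theorem isLinearMap_vD (f : E × E → V) (p : E × E) : IsLinearMap ℝ fun w => vD w f p :=
  ⟨fun v w => vD_add_dir v w f p, fun c w => vD_smul_dir c w f p⟩

theorem isLinearMap_bD (f : E × E → V) (p : E × E) : IsLinearMap ℝ fun w => bD w f p :=
  ⟨fun v w => bD_add_dir v w f p, fun c w => bD_smul_dir c w f p⟩

theorem isLinearMap_fderiv_vD (hΩ : IsOpen Ω) (hf : SmoothOn Ω f) {p : E × E} (hp : p ∈ Ω)
    (c : E × E) : IsLinearMap ℝ fun w => fderiv ℝ (vD w f) p c := by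
  have h : (fun w => fderiv ℝ (vD w f) p c) = fun w => vD w (fun q => fderiv ℝ f q c) p := by
    funext w
    have := fderiv_along hΩ hf hp (differentiableAt_const ((0 : E), w)) c
    simp at this
    exact this
  exact h ▸ isLinearMap_vD _ p

theorem isLinearMap_vD_vD (hΩ : IsOpen Ω) (hf : SmoothOn Ω f) {p : E × E} (hp : p ∈ Ω)
    (u : E) : IsLinearMap ℝ fun w => vD u (vD w f) p :=
  isLinearMap_fderiv_vD hΩ hf hp _

theorem isLinearMap_sD_vD (hΩ : IsOpen Ω) (hf : SmoothOn Ω f) {p : E × E} (hp : p ∈ Ω) :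
    IsLinearMap ℝ fun w => sD G (vD w f) p :=
  isLinearMap_fderiv_vD hΩ hf hp _

theorem isLinearMap_vD_vD_vD (hΩ : IsOpen Ω) (hf : SmoothOn Ω f) {p : E × E} (hp : p ∈ Ω)
    (u v : E) : IsLinearMap ℝ fun w => vD u (vD v (vD w f)) p := by
  have h : (fun w => vD u (vD v (vD w f)) p) = fun w => vD w (vD u (vD v f)) p := by
    funext w
    rw [vD_congr hΩ (fun q hq => vD_comm hΩ hf hq v w) u hp, vD_comm hΩ (hf.vD hΩ v) hp]
  exact h ▸ isLinearMap_vD _ p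

theorem uncurry_pdy_eqOn {Ω : Set (Pt n × Pt n)} (hΩ : IsOpen Ω) {f : Pt n → Pt n → ℝ}
    {g : Pt n × Pt n → ℝ} (hg : SmoothOn Ω g) (h : Ω.EqOn (Function.uncurry f) g) (i : Fin n) :
    Ω.EqOn (Function.uncurry (pdy f i)) (vD (Pi.single i 1) g) := by
  rintro ⟨x, y⟩ hp
  have hd := (SmoothOn.differentiableAt hΩ (hg.congr h) hp).hasFDerivAt
  have := (HasFDerivAt.comp (f := fun y => (x, y)) y hd
    (hasFDerivAt_prodMk_right x y)).fderiv
  rw [fderiv_congr_on hΩ h hp] at this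
  exact congrArg (fun A => A (Pi.single i 1)) this

theorem uncurry_pdx_eqOn {Ω : Set (Pt n × Pt n)} (hΩ : IsOpen Ω) {f : Pt n → Pt n → ℝ}
    {g : Pt n × Pt n → ℝ} (hg : SmoothOn Ω g) (h : Ω.EqOn (Function.uncurry f) g) (i : Fin n) :
    Ω.EqOn (Function.uncurry (pdx f i)) (bD (Pi.single i 1) g) := by
  rintro ⟨x, y⟩ hp
  have hd := (SmoothOn.differentiableAt hΩ (hg.congr h) hp).hasFDerivAt
  have := (HasFDerivAt.comp (f := fun x => (x, y)) x hd
    (hasFDerivAt_prodMk_left x y)).fderiv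
  rw [fderiv_congr_on hΩ h hp] at this
  exact congrArg (fun A => A (Pi.single i 1)) this

theorem vD_component {Ω : Set (E × E)} (hΩ : IsOpen Ω) {H : E × E → Pt n} (hH : SmoothOn Ω H)
    {p : E × E} (hp : p ∈ Ω) (w : E) (i : Fin n) : vD w (fun q => H q i) p = vD w H p i := by
  simp only [vD]
  rw [fderiv_apply (hH.differentiableAt hΩ hp)]
  rfl

theorem bD_component {Ω : Set (E × E)} (hΩ : IsOpen Ω) {H : E × E → Pt n} (hH : SmoothOn Ω H)
    {p : E × E} (hp : p ∈ Ω) (w : E) (i : Fin n) : bD w (fun q => H q i) p = bD w H p i := by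
  simp only [bD]
  rw [fderiv_apply (hH.differentiableAt hΩ hp)]
  rfl

end Coordinates

noncomputable section FinslerMetric

open Function

variable {n : ℕ} {U : Set (Pt n)} {F : Pt n → Pt n → ℝ}

/-- The slit tangent bundle over `U`. -/
abbrev slit (U : Set (Pt n)) : Set (Pt n × Pt n) := U ×ˢ {y : Pt n | y ≠ 0}

/-- The energy `F²` as a function on the tangent bundle. -/
def energy (F : Pt n → Pt n → ℝ) : Pt n × Pt n → ℝ := uncurry (F2 F)

/-- The vector of spray coefficients as a function on the tangent bundle. -/
def spray (F : Pt n → Pt n → ℝ) : Pt n × Pt n → Pt n := fun p i => Gspray F i p.1 p.2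

namespace IsFinslerMetric

theorem isOpen_slit (hF : IsFinslerMetric U F) : IsOpen (slit U) :=
  hF.isOpen.prod isOpen_ne

theorem smoothOn_energy (hF : IsFinslerMetric U F) : SmoothOn (slit U) (energy F) :=
  hF.smooth.pow 2

theorem energy_pos (hF : IsFinslerMetric U F) {p : Pt n × Pt n} (hp : p ∈ slit U) :
    0 < energy F p :=
  pow_pos (hF.pos _ hp.1 _ hp.2) 2

theorem pdy_energy (hF : IsFinslerMetric U F) (i : Fin n) :
    (slit U).EqOn (uncurry (pdy (F2 F) i)) (vD (Pi.single i 1) (energy F)) :=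
  uncurry_pdy_eqOn hF.isOpen_slit hF.smoothOn_energy (fun _ _ => rfl) i

theorem pdy_pdy_energy (hF : IsFinslerMetric U F) (i j : Fin n) :
    (slit U).EqOn (uncurry (pdy (pdy (F2 F) j) i))
      (vD (Pi.single i 1) (vD (Pi.single j 1) (energy F))) :=
  uncurry_pdy_eqOn hF.isOpen_slit (hF.smoothOn_energy.vD hF.isOpen_slit _) (hF.pdy_energy j) i

theorem gLow_eq (hF : IsFinslerMetric U F) (i j : Fin n) {p : Pt n × Pt n} (hp : p ∈ slit U) :
    gLow F i j p.1 p.2 = 1 / 2 * vD (Pi.single i 1) (vD (Pi.single j 1) (energy F)) p :=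
  congrArg (1 / 2 * ·) (hF.pdy_pdy_energy i j hp)

theorem cartan_eq (hF : IsFinslerMetric U F) (i j k : Fin n) {p : Pt n × Pt n}
    (hp : p ∈ slit U) :
    Cartan F i j k p.1 p.2 =
      1 / 4 * vD (Pi.single i 1) (vD (Pi.single j 1) (vD (Pi.single k 1) (energy F))) p :=
  congrArg (1 / 4 * ·) (uncurry_pdy_eqOn hF.isOpen_slit
    ((hF.smoothOn_energy.vD hF.isOpen_slit _).vD hF.isOpen_slit _) (hF.pdy_pdy_energy j k) i hp)

theorem smoothOn_gLow (hF : IsFinslerMetric U F) (i j : Fin n) :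
    SmoothOn (slit U) fun p => gLow F i j p.1 p.2 :=
  (contDiffOn_const.mul ((hF.smoothOn_energy.vD hF.isOpen_slit _).vD hF.isOpen_slit _)).congr
    fun _ hp => hF.gLow_eq i j hp

end IsFinslerMetric

theorem smoothOn_det {ι : Type*} [Fintype ι] [DecidableEq ι] {Ω : Set (Pt n × Pt n)}
    {M : Pt n × Pt n → Matrix ι ι ℝ} (hM : ∀ i j, SmoothOn Ω fun p => M p i j) :
    SmoothOn Ω fun p => (M p).det := by
  simp only [Matrix.det_apply']
  exact ContDiffOn.sum fun σ _ => contDiffOn_const.mul (contDiffOn_prod fun i _ => hM _ _)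

theorem smoothOn_inv {ι : Type*} [Fintype ι] [DecidableEq ι] {Ω : Set (Pt n × Pt n)}
    {M : Pt n × Pt n → Matrix ι ι ℝ} (hM : ∀ i j, SmoothOn Ω fun p => M p i j)
    (h0 : ∀ p ∈ Ω, (M p).det ≠ 0) (i j : ι) : SmoothOn Ω fun p => (M p)⁻¹ i j := by
  simp only [Matrix.inv_def, Ring.inverse_eq_inv', Matrix.smul_apply, smul_eq_mul,
    Matrix.adjugate_apply]
  refine ((smoothOn_det hM).inv h0).mul (smoothOn_det fun a b => ?_)
  simp only [Matrix.updateRow_apply]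
  split_ifs
  · exact contDiffOn_const
  · exact hM a b

namespace IsFinslerMetric

theorem smoothOn_gInv (hF : IsFinslerMetric U F) (i j : Fin n) :
    SmoothOn (slit U) fun p => gInv F i j p.1 p.2 :=
  smoothOn_inv (M := fun p => gMat F p.1 p.2) (fun i j => hF.smoothOn_gLow i j)
    (fun p hp => (hF.posdef p.1 hp.1 p.2 hp.2).det_pos.ne') i j

theorem pdx_pdy_energy (hF : IsFinslerMetric U F) (i j : Fin n) {p : Pt n × Pt n}
    (hp : p ∈ slit U) :
    pdx (pdy (F2 F) j) i p.1 p.2 = bD (Pi.single i 1) (vD (Pi.single j 1) (energy F)) p :=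
  uncurry_pdx_eqOn hF.isOpen_slit (hF.smoothOn_energy.vD hF.isOpen_slit _) (hF.pdy_energy j) i hp

theorem pdx_energy (hF : IsFinslerMetric U F) (i : Fin n) {p : Pt n × Pt n}
    (hp : p ∈ slit U) : pdx (F2 F) i p.1 p.2 = bD (Pi.single i 1) (energy F) p :=
  uncurry_pdx_eqOn hF.isOpen_slit hF.smoothOn_energy (fun _ _ => rfl) i hp

theorem smoothOn_coord {Ω : Set (Pt n × Pt n)} (i : Fin n) : SmoothOn Ω fun p => p.2 i :=
  (contDiffOn_pi.1 contDiffOn_snd) i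

theorem smoothOn_spray (hF : IsFinslerMetric U F) : SmoothOn (slit U) (spray F) := by
  have hΩ := hF.isOpen_slit
  have hL := hF.smoothOn_energy
  refine contDiffOn_pi.2 fun i => contDiffOn_const.mul (ContDiffOn.sum fun l _ =>
    (hF.smoothOn_gInv i l).mul (ContDiffOn.sub (ContDiffOn.sum fun k _ => ?_) ?_))
  · exact (smoothOn_coord k).mul (((hL.vD hΩ _).bD hΩ _).congr fun p hp =>
      hF.pdx_pdy_energy k l hp)
  · exact (hL.bD hΩ _).congr fun p hp => hF.pdx_energy l hp

theorem euler_energy (hF : IsFinslerMetric U F) {p : Pt n × Pt n} (hp : p ∈ slit U) :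
    vD p.2 (energy F) p = 2 * energy F p := by
  have hd := (hF.smoothOn_energy.differentiableAt hF.isOpen_slit hp).hasFDerivAt
  have hc : HasDerivAt (fun t : ℝ => (p.1, t • p.2)) ((0 : Pt n), p.2) 1 := by
    simpa using (hasDerivAt_const (1 : ℝ) p.1).prodMk ((hasDerivAt_id (1 : ℝ)).smul_const p.2)
  have h1 : HasDerivAt (fun t : ℝ => energy F (p.1, t • p.2)) (vD p.2 (energy F) p) 1 :=
    HasFDerivAt.comp_hasDerivAt (f := fun t : ℝ => (p.1, t • p.2)) (1 : ℝ)
      (by rw [one_smul]; exact hd) hc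
  have h2 : HasDerivAt (fun t : ℝ => t ^ 2 * energy F p) (2 * energy F p) 1 := by
    simpa using (hasDerivAt_pow 2 (1 : ℝ)).mul_const (energy F p)
  refine h1.unique (h2.congr_of_eventuallyEq ?_)
  filter_upwards [lt_mem_nhds (zero_lt_one' ℝ)] with t ht
  change F p.1 (t • p.2) ^ 2 = t ^ 2 * F p.1 p.2 ^ 2
  rw [hF.homog _ hp.1 _ hp.2 t ht, mul_pow]

theorem euler_vD_energy (hF : IsFinslerMetric U F) {p : Pt n × Pt n} (hp : p ∈ slit U)
    (w : Pt n) : vD p.2 (vD w (energy F)) p = vD w (energy F) p := by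
  rw [euler_vD hF.isOpen_slit hF.smoothOn_energy (fun q hq => hF.euler_energy hq) hp]
  ring

theorem yLow_eq (hF : IsFinslerMetric U F) (i : Fin n) {p : Pt n × Pt n} (hp : p ∈ slit U) :
    yLow F i p.1 p.2 = 1 / 2 * vD (Pi.single i 1) (energy F) p := by
  have hΩ := hF.isOpen_slit
  have hL := hF.smoothOn_energy
  rw [← hF.euler_vD_energy hp, vD_comm hΩ hL hp,
    isLinearMap_eq_sum (isLinearMap_vD_vD hΩ hL hp _) p.2, Finset.mul_sum]
  refine Finset.sum_congr rfl fun j _ => ?_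
  rw [hF.gLow_eq i j hp, smul_eq_mul]
  ring

theorem hessian_eq (hF : IsFinslerMetric U F) {p : Pt n × Pt n} (hp : p ∈ slit U) (v w : Pt n) :
    vD v (vD w (energy F)) p = 2 * (v ⬝ᵥ (gMat F p.1 p.2).mulVec w) := by
  have hΩ := hF.isOpen_slit
  have hL := hF.smoothOn_energy
  rw [isLinearMap_eq_sum (isLinearMap_vD _ p) v, dotProduct, Finset.mul_sum]
  refine Finset.sum_congr rfl fun i _ => ?_
  rw [isLinearMap_eq_sum (isLinearMap_vD_vD hΩ hL hp _) w, smul_eq_mul, Matrix.mulVec,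
    dotProduct, Finset.mul_sum, Finset.mul_sum, Finset.mul_sum]
  refine Finset.sum_congr rfl fun j _ => ?_
  rw [gMat, Matrix.of_apply, hF.gLow_eq i j hp, smul_eq_mul]
  ring

theorem hessian_pos (hF : IsFinslerMetric U F) {p : Pt n × Pt n} (hp : p ∈ slit U) {v : Pt n}
    (hv : v ≠ 0) : 0 < vD v (vD v (energy F)) p := by
  rw [hF.hessian_eq hp]
  have := (hF.posdef p.1 hp.1 p.2 hp.2).dotProduct_mulVec_pos hv
  simp only [star_trivial] at this
  linarith

theorem nondegenerate (hF : IsFinslerMetric U F) {p : Pt n × Pt n} (hp : p ∈ slit U) {u : Pt n}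
    (h : ∀ w, vD u (vD w (energy F)) p = 0) : u = 0 := by
  by_contra hu
  exact (hF.hessian_pos hp hu).ne' (h u)

theorem gMat_mulVec_spray (hF : IsFinslerMetric U F) {p : Pt n × Pt n} (hp : p ∈ slit U) :
    (gMat F p.1 p.2).mulVec (spray F p) = fun l => 1 / 4 *
      (bD p.2 (vD (Pi.single l 1) (energy F)) p - bD (Pi.single l 1) (energy F) p) := by
  have h : spray F p = (gMat F p.1 p.2)⁻¹.mulVec fun l => 1 / 4 *
      (bD p.2 (vD (Pi.single l 1) (energy F)) p - bD (Pi.single l 1) (energy F) p) := by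
    funext i
    rw [Matrix.mulVec, dotProduct, spray, Gspray, Finset.mul_sum]
    refine Finset.sum_congr rfl fun l _ => ?_
    rw [hF.pdx_energy l hp, isLinearMap_eq_sum (isLinearMap_bD _ p) p.2]
    simp only [hF.pdx_pdy_energy _ _ hp, gInv, smul_eq_mul]
    ring
  rw [h, Matrix.mulVec_mulVec, Matrix.mul_nonsing_inv, Matrix.one_mulVec]
  exact (hF.posdef p.1 hp.1 p.2 hp.2).det_pos.ne'.isUnit

theorem euler_lagrange (hF : IsFinslerMetric U F) {p : Pt n × Pt n} (hp : p ∈ slit U)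
    (w : Pt n) : sD (spray F) (vD w (energy F)) p = bD w (energy F) p := by
  have hΩ := hF.isOpen_slit
  have hL := hF.smoothOn_energy
  refine eq_of_isLinearMap_of_single (isLinearMap_sD_vD hΩ hL hp) (isLinearMap_bD _ p)
    (fun l => ?_) w
  rw [sD_eq, vD_comm hΩ hL hp, hF.hessian_eq hp, hF.gMat_mulVec_spray hp]
  simp
  ring

theorem euler_spray (hF : IsFinslerMetric U F) {p : Pt n × Pt n} (hp : p ∈ slit U) :
    vD p.2 (spray F) p = (2 : ℝ) • spray F p :=
  _root_.euler_spray hF.isOpen_slit hF.smoothOn_energy hF.smoothOn_spray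
    (fun _ hq => hF.euler_energy hq) (fun w _ hq => hF.euler_lagrange hq w) hp
    (fun _ hu => hF.nondegenerate hp hu)

end IsFinslerMetric

end FinslerMetric

noncomputable section IsotropicBerwald

open Function

variable {n : ℕ} {U : Set (Pt n)} {F μ lam K : Pt n → Pt n → ℝ}

namespace IsFinslerMetric

theorem spray_component (hF : IsFinslerMetric U F) (i : Fin n) :
    SmoothOn (slit U) fun p => spray F p i :=
  contDiffOn_pi.1 hF.smoothOn_spray i

theorem ncon_eqOn (hF : IsFinslerMetric U F) (i j : Fin n) :
    (slit U).EqOn (uncurry (Ncon F i j)) (vD (Pi.single j 1) fun p => spray F p i) :=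
  uncurry_pdy_eqOn hF.isOpen_slit (hF.spray_component i) (fun _ _ => rfl) j

theorem pdy_pdy_spray (hF : IsFinslerMetric U F) (i j k : Fin n) :
    (slit U).EqOn (uncurry (pdy (pdy (Gspray F i) k) j))
      (vD (Pi.single j 1) (vD (Pi.single k 1) fun p => spray F p i)) :=
  uncurry_pdy_eqOn hF.isOpen_slit ((hF.spray_component i).vD hF.isOpen_slit _)
    (hF.ncon_eqOn i k) j

theorem vD_spray_component (hF : IsFinslerMetric U F) (v : Pt n) (i : Fin n) :
    (slit U).EqOn (vD v fun p => spray F p i) fun p => vD v (spray F) p i :=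
  fun _ hp => vD_component hF.isOpen_slit hF.smoothOn_spray hp v i

theorem bcurv_eq (hF : IsFinslerMetric U F) (i j k l : Fin n) {p : Pt n × Pt n}
    (hp : p ∈ slit U) :
    Bcurv F i j k l p.1 p.2 =
      vD (Pi.single j 1) (vD (Pi.single k 1) (vD (Pi.single l 1) (spray F))) p i := by
  have hΩ := hF.isOpen_slit
  have hG := hF.smoothOn_spray
  have h2 := vD_congr hΩ (vD_congr hΩ (hF.vD_spray_component (Pi.single l 1) i)
    (Pi.single k 1)) (Pi.single j 1)
  have h3 := vD_congr hΩ (fun q hq => vD_component hΩ (hG.vD hΩ (Pi.single l 1)) hq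
    (Pi.single k 1) i) (Pi.single j 1)
  exact (uncurry_pdy_eqOn hΩ (((hF.spray_component i).vD hΩ _).vD hΩ _)
    (hF.pdy_pdy_spray i k l) j hp).trans <| (h2 hp).trans <| (h3 hp).trans <|
      vD_component hΩ ((hG.vD hΩ _).vD hΩ _) hp _ i

theorem riemann_eq (hF : IsFinslerMetric U F) (i k : Fin n) {p : Pt n × Pt n}
    (hp : p ∈ slit U) :
    RiemK F i k p.1 p.2 = ((2 : ℝ) • bD (Pi.single k 1) (spray F) p
      - sD (spray F) (vD (Pi.single k 1) (spray F)) p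
      - vDf (vD (Pi.single k 1) (spray F)) (spray F) p) i := by
  have hΩ := hF.isOpen_slit
  have hG := hF.smoothOn_spray
  have e1 : pdx (Gspray F i) k p.1 p.2 = bD (Pi.single k 1) (spray F) p i :=
    (uncurry_pdx_eqOn hΩ (hF.spray_component i) (fun _ _ => rfl) k hp).trans
      (bD_component hΩ hG hp _ i)
  have e2 (j : Fin n) : pdx (pdy (Gspray F i) k) j p.1 p.2 =
      bD (Pi.single j 1) (vD (Pi.single k 1) (spray F)) p i :=
    (uncurry_pdx_eqOn hΩ ((hF.spray_component i).vD hΩ _) (hF.ncon_eqOn i k) j hp).trans <|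
      (bD_congr hΩ (hF.vD_spray_component _ i) _ hp).trans
        (bD_component hΩ (hG.vD hΩ _) hp _ i)
  have e3 (j : Fin n) : Γcon F i j k p.1 p.2 =
      vD (Pi.single j 1) (vD (Pi.single k 1) (spray F)) p i :=
    (hF.pdy_pdy_spray i j k hp).trans <| (vD_congr hΩ (hF.vD_spray_component _ i) _ hp).trans
        (vD_component hΩ (hG.vD hΩ _) hp _ i)
  have e4 (i j : Fin n) : Ncon F i j p.1 p.2 = vD (Pi.single j 1) (spray F) p i :=
    (hF.ncon_eqOn i j hp).trans (hF.vD_spray_component _ i hp)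
  have e5 := congrFun (isLinearMap_eq_sum
    (isLinearMap_bD (vD (Pi.single k 1) (spray F)) p) p.2) i
  have e6 := congrFun (isLinearMap_eq_sum
    (isLinearMap_vD (vD (Pi.single k 1) (spray F)) p) (spray F p)) i
  have e7 := congrFun (isLinearMap_eq_sum
    (isLinearMap_vD (spray F) p) (vD (Pi.single k 1) (spray F) p)) i
  simp only [Finset.sum_apply, Pi.smul_apply, smul_eq_mul] at e5 e6 e7
  simp only [RiemK, e1, e2, e3, e4, sD_eq, vDf_eq, Pi.sub_apply, Pi.smul_apply, smul_eq_mul,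
    e5, e6, e7, mul_comm (vD (Pi.single _ 1) (spray F) p i)]
  simp only [spray]
  ring

theorem riemann_scalar (hF : IsFinslerMetric U F) (hK : IsScalarFlagCurv U F K)
    {p : Pt n × Pt n} (hp : p ∈ slit U) (v : Pt n) :
    sD (spray F) (vD v (spray F)) p = (2 : ℝ) • bD v (spray F) p
      - vDf (vD v (spray F)) (spray F) p - scalarCurv (energy F) (uncurry K) v p := by
  have hΩ := hF.isOpen_slit
  have hG := hF.smoothOn_spray
  refine eq_of_isLinearMap_of_single (A := fun v => sD (spray F) (vD v (spray F)) p)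
    (B := fun v => (2 : ℝ) • bD v (spray F) p - vDf (vD v (spray F)) (spray F) p
      - scalarCurv (energy F) (uncurry K) v p) (isLinearMap_sD_vD hΩ hG hp) ?_ (fun k => ?_) v
  · constructor
    · intro v w
      simp only [bD_add_dir, vDf_eq, vD_add_dir, scalarCurv]
      module
    · intro c v
      simp only [bD_smul_dir, vDf_eq, vD_smul_dir, scalarCurv, smul_eq_mul]
      module
  · funext i
    have h1 := (hF.riemann_eq i k hp).symm.trans (hK.2 p.1 hp.1 p.2 hp.2 i k)
    have h2 : F p.1 p.2 ≠ 0 := (hF.pos _ hp.1 _ hp.2).ne'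
    rw [hUp, hF.yLow_eq k hp] at h1
    have h3 : energy F p = F p.1 p.2 ^ 2 := rfl
    have h4 : uncurry K p = K p.1 p.2 := rfl
    have h5 : (Pi.single k 1 : Pt n) i = if i = k then 1 else 0 := Pi.single_apply k 1 i
    simp only [Pi.sub_apply, Pi.smul_apply, Pi.add_apply, smul_eq_mul, scalarCurv] at h1 ⊢
    rw [h3, h4, h5]
    field_simp at h1 ⊢
    linarith

theorem spray_deriv_eq (hF : IsFinslerMetric U F) {f : Pt n → Pt n → ℝ}
    (hf : SmoothOn (slit U) (uncurry f)) {p : Pt n × Pt n} (hp : p ∈ slit U) :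
    ∑ s, hD0 F f s p.1 p.2 * p.2 s = sD (spray F) (uncurry f) p := by
  have hΩ := hF.isOpen_slit
  have e1 (s : Fin n) : pdx f s p.1 p.2 = bD (Pi.single s 1) (uncurry f) p :=
    uncurry_pdx_eqOn hΩ hf (fun _ _ => rfl) s hp
  have e2 (s : Fin n) : pdy f s p.1 p.2 = vD (Pi.single s 1) (uncurry f) p :=
    uncurry_pdy_eqOn hΩ hf (fun _ _ => rfl) s hp
  have e4 (i j : Fin n) : Ncon F i j p.1 p.2 = vD (Pi.single j 1) (spray F) p i :=
    (hF.ncon_eqOn i j hp).trans (hF.vD_spray_component _ i hp)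
  rw [sD_eq, ← vD_smul_dir, ← hF.euler_spray hp, isLinearMap_eq_sum (isLinearMap_bD _ p) p.2,
    isLinearMap_eq_sum (isLinearMap_vD (uncurry f) p) (vD p.2 (spray F) p)]
  simp only [hD0, e1, e2, e4, isLinearMap_eq_sum (isLinearMap_vD (spray F) p) p.2,
    Finset.sum_apply, Pi.smul_apply, smul_eq_mul, sub_mul, Finset.sum_sub_distrib, Finset.sum_mul]
  congr 1
  · exact Finset.sum_congr rfl fun _ _ => mul_comm _ _
  · rw [Finset.sum_comm]
    exact Finset.sum_congr rfl fun _ _ => Finset.sum_congr rfl fun _ _ => by ring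

theorem sD_norm (hF : IsFinslerMetric U F) {p : Pt n × Pt n} (hp : p ∈ slit U) :
    sD (spray F) (uncurry F) p = 0 := by
  have hΩ := hF.isOpen_slit
  have h1 := sD_energy hΩ hF.smoothOn_energy (fun _ hq => hF.euler_energy hq)
    (fun w _ hq => hF.euler_lagrange hq w) hp
  have h2 := sD_mul (G := spray F) hΩ hF.smooth hF.smooth hp
  have h3 : (fun q => uncurry F q * uncurry F q) = energy F := by
    funext q
    exact (sq _).symm
  rw [h3, h1] at h2
  have h4 : 0 < uncurry F p := hF.pos _ hp.1 _ hp.2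
  nlinarith

theorem exists_not_smul (hF : IsFinslerMetric U F) {y : Pt n} (hy : y ≠ 0) :
    ∃ u : Pt n, ∀ c : ℝ, u ≠ c • y := by
  obtain ⟨i, hi⟩ := Function.ne_iff.1 hy
  have : Nontrivial (Fin n) := Fin.nontrivial_iff_two_le.2 hF.dim
  obtain ⟨j, hj⟩ := exists_ne i
  refine ⟨Pi.single j 1, fun c h => ?_⟩
  have h1 := congrFun h i
  have h2 := congrFun h j
  simp [hj.symm] at h1 h2
  rcases h1 with rfl | h1
  · simp at h2
  · exact hi h1

end IsFinslerMetric

namespace IsGIB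

theorem berwald_energy (hF : IsGIB U F μ lam) {p : Pt n × Pt n} (hp : p ∈ slit U)
    (u v w : Pt n) :
    vD (vD u (vD v (vD w (spray F))) p) (energy F) p =
      1 / 2 * (μ p.1 p.2 * F p.1 p.2 * vD u (vD v (vD w (energy F))) p) := by
  have hΩ := hF.finsler.isOpen_slit
  have hG := hF.finsler.smoothOn_spray
  have hL := hF.finsler.smoothOn_energy
  have hpos : F p.1 p.2 ≠ 0 := (hF.finsler.pos _ hp.1 _ hp.2).ne'
  have comp {A : Pt n → Pt n} (hA : IsLinearMap ℝ A) :
      IsLinearMap ℝ fun w => vD (A w) (energy F) p :=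
    ⟨fun a b => by rw [hA.map_add, vD_add_dir], fun c a => by rw [hA.map_smul, vD_smul_dir]⟩
  have scale {A : Pt n → ℝ} (hA : IsLinearMap ℝ A) :
      IsLinearMap ℝ fun w => 1 / 2 * (μ p.1 p.2 * F p.1 p.2 * A w) :=
    ⟨fun a b => by simp only [hA.map_add]; ring, fun c a => by
      simp only [hA.map_smul, smul_eq_mul]; ring⟩
  refine eq_of_isLinearMap_of_single (comp (isLinearMap_vD_vD_vD hΩ hG hp u v))
    (scale (isLinearMap_vD_vD_vD hΩ hL hp u v)) (fun l => ?_) w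
  refine eq_of_isLinearMap_of_single (comp (isLinearMap_vD_vD hΩ (hG.vD hΩ _) hp u))
    (scale (isLinearMap_vD_vD hΩ (hL.vD hΩ _) hp u)) (fun k => ?_) v
  refine eq_of_isLinearMap_of_single (comp (isLinearMap_vD _ p))
    (scale (isLinearMap_vD _ p)) (fun j => ?_) u
  have hy (i : Fin n) : vD (Pi.single i 1) (energy F) p = 2 * yLow F i p.1 p.2 := by
    rw [hF.finsler.yLow_eq i hp]; ring
  have hyy : ∑ i, p.2 i * yLow F i p.1 p.2 = F p.1 p.2 ^ 2 := by
    have h1 := (isLinearMap_eq_sum (isLinearMap_vD (energy F) p) p.2).symm.trans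
      (hF.finsler.euler_energy hp)
    simp only [hy, smul_eq_mul, mul_left_comm _ (2 : ℝ), ← Finset.mul_sum] at h1
    exact mul_left_cancel₀ two_ne_zero h1
  have hell : ∑ i, ell F i p.1 p.2 * yLow F i p.1 p.2 = F p.1 p.2 := by
    simp only [ell, div_mul_eq_mul_div, ← Finset.sum_div, hyy]
    field_simp
  have hh (j : Fin n) : ∑ i, hUp F i j p.1 p.2 * yLow F i p.1 p.2 = 0 := by
    have (i : Fin n) : hUp F i j p.1 p.2 * yLow F i p.1 p.2 =
        (if i = j then yLow F i p.1 p.2 else 0) -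
          p.2 i * yLow F i p.1 p.2 * (yLow F j p.1 p.2 / F p.1 p.2 ^ 2) := by
      rw [hUp]; split_ifs <;> ring
    simp only [this, Finset.sum_sub_distrib, ← Finset.sum_mul, hyy, Finset.sum_ite_eq',
      Finset.mem_univ, if_true]
    field_simp
    ring
  have hC := hF.finsler.cartan_eq j k l hp
  rw [isLinearMap_eq_sum (isLinearMap_vD (energy F) p)]
  have hterm (i : Fin n) : vD (Pi.single j 1) (vD (Pi.single k 1) (vD (Pi.single l 1)
      (spray F))) p i • vD (Pi.single i 1) (energy F) p =
      2 * μ p.1 p.2 * Cartan F j k l p.1 p.2 * (ell F i p.1 p.2 * yLow F i p.1 p.2)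
      + 2 * lam p.1 p.2 * hLow F k l p.1 p.2 * (hUp F i j p.1 p.2 * yLow F i p.1 p.2)
      + 2 * lam p.1 p.2 * hLow F j l p.1 p.2 * (hUp F i k p.1 p.2 * yLow F i p.1 p.2)
      + 2 * lam p.1 p.2 * hLow F j k p.1 p.2 * (hUp F i l p.1 p.2 * yLow F i p.1 p.2) := by
    rw [← hF.finsler.bcurv_eq i j k l hp, hF.berwald p.1 hp.1 p.2 hp.2, hy, smul_eq_mul]
    ring
  simp only [hterm, Finset.sum_add_distrib, ← Finset.mul_sum, hell, hh, hC]
  ring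

end IsGIB

end IsotropicBerwald

noncomputable section ConstantCurvature

open Function

variable {n : ℕ} {U : Set (Pt n)} {F μ lam K : Pt n → Pt n → ℝ}

namespace IsFinslerMetric

theorem isPreconnected_slit (hF : IsFinslerMetric U F) : IsPreconnected (slit U) := by
  refine hF.connected.isPreconnected.prod
    (isConnected_compl_singleton_of_one_lt_rank ?_ 0).isPreconnected
  rw [rank_fin_fun]
  exact_mod_cast hF.dim

/-- A flag curvature depending on the position only is locally constant in dimension at least
three. -/
theorem bD_flagCurv_eq_zero (hn : 3 ≤ n) (hF : IsFinslerMetric U F)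
    (hK : IsScalarFlagCurv U F K) (hKv : ∀ p ∈ slit U, ∀ v, vD v (uncurry K) p = 0)
    {p : Pt n × Pt n} (hp : p ∈ slit U) (v : Pt n) : bD v (uncurry K) p = 0 := by
  have hΩ := hF.isOpen_slit
  have hL := hF.smoothOn_energy
  have hG := hF.smoothOn_spray
  have hκs : SmoothOn (slit U) (uncurry K) := hK.1
  suffices h : ∀ i, bD (Pi.single i 1) (uncurry K) p = 0 by
    rw [isLinearMap_eq_sum (isLinearMap_bD (uncurry K) p) v]
    simp [h]
  intro i
  have : Nontrivial (Fin n) := Fin.nontrivial_iff_two_le.2 hF.dim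
  obtain ⟨j, hj⟩ := exists_ne i
  obtain ⟨k, hki, hkj⟩ := Fin.exists_ne_and_ne_of_two_lt i j hn
  have hcross : ∀ q ∈ slit U, bD (Pi.single i 1) (uncurry K) q * vD (Pi.single j 1) (energy F) q
      - bD (Pi.single j 1) (uncurry K) q * vD (Pi.single i 1) (energy F) q = 0 := by
    intro q hq
    have h := congrFun (bianchi_isotropic hΩ hL hG hK.1
      (fun v q hq => bD_energy hΩ hL hG (fun _ hr => hF.euler_energy hr)
        (fun w _ hr => hF.euler_lagrange hr w) hq v)
      (fun v q hq => hF.riemann_scalar hK hq v) hKv hq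
      (Pi.single i 1) (Pi.single j 1) (Pi.single k 1)) k
    simp only [Pi.add_apply, Pi.sub_apply, Pi.smul_apply, smul_eq_mul, Pi.single_eq_same,
      Pi.single_eq_of_ne hki, Pi.single_eq_of_ne hkj, Pi.zero_apply] at h
    linarith
  have hκ : ∀ l w, vD w (bD (Pi.single l 1) (uncurry K)) p = 0 := by
    intro l w
    rw [vD_bD_comm hΩ hK.1 hp, bD_congr hΩ (g := fun _ => (0 : ℝ)) (fun q hq => hKv q hq w) _ hp]
    simp [bD]
  have hzero : bD (Pi.single i 1) (uncurry K) p • (Pi.single j 1 : Pt n)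
      - bD (Pi.single j 1) (uncurry K) p • (Pi.single i 1 : Pt n) = 0 := by
    refine hF.nondegenerate hp fun w => ?_
    have h := vD_congr hΩ (g := fun _ => (0 : ℝ)) hcross w hp
    rw [vD_sub hΩ ((hκs.bD hΩ _).mul (hL.vD hΩ _)) ((hκs.bD hΩ _).mul (hL.vD hΩ _)) hp,
      vD_mul hΩ (hκs.bD hΩ _) (hL.vD hΩ _) hp, vD_mul hΩ (hκs.bD hΩ _) (hL.vD hΩ _) hp,
      hκ, hκ] at h
    have h0 : vD w (fun _ : Pt n × Pt n => (0 : ℝ)) p = 0 := by simp [vD]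
    rw [h0] at h
    rw [vD_sub_dir, vD_smul_dir, vD_smul_dir, vD_comm hΩ hL hp _ w, vD_comm hΩ hL hp _ w,
      smul_eq_mul, smul_eq_mul]
    linarith
  simpa [hj] using congrFun hzero j

end IsFinslerMetric

/-- The flag curvature does not depend on the direction. -/
theorem IsGIB.vD_flagCurv_eq_zero (hF : IsGIB U F μ lam) (hK : IsScalarFlagCurv U F K)
    (heq : ∀ x ∈ U, ∀ y : Pt n, y ≠ 0 →
      2 * (∑ s, hD0 F μ s x y * y s) - ((μ x y) ^ 2 + 4 * K x y) * F x y = 0)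
    {p : Pt n × Pt n} (hp : p ∈ slit U) (v : Pt n) : vD v (uncurry K) p = 0 := by
  have hf := hF.finsler
  have hΩ := hf.isOpen_slit
  have hL := hf.smoothOn_energy
  have hG := hf.smoothOn_spray
  refine _root_.vD_flagCurv_eq_zero (hf.energy_pos hp) (fun v w => vD_comm hΩ hL hp v w)
    (hf.euler_energy hp) (hf.euler_vD_energy hp) (fun u v c w => ?_)
    (fun v hv => hf.hessian_pos hp hv) (hf.exists_not_smul hp.2) (fun v => ?_) v
  · have h := isLinearMap_vD_vD hΩ hL hp u
    rw [h.map_add, h.map_smul, smul_eq_mul]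
  · refine vD_flagCurv_mul_eq_zero (m := fun q => uncurry μ q * uncurry F q) hΩ hL hG hK.1
      (hF.smooth_mu.mul hf.smooth) (fun _ hq => hf.euler_energy hq)
      (fun w _ hq => hf.euler_lagrange hq w) (fun v _ hq => hf.riemann_scalar hK hq v)
      (fun u v _ hq => hF.berwald_energy hq u v v) (fun q hq => ?_) hp v
    have h := heq q.1 hq.1 q.2 hq.2
    rw [hf.spray_deriv_eq hF.smooth_mu hq] at h
    rw [sD_mul hΩ hF.smooth_mu hf.smooth hq, hf.sD_norm hq]
    change 2 * (_ * F q.1 q.2 + μ q.1 q.2 * 0) =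
      (μ q.1 q.2 * F q.1 q.2) ^ 2 + 4 * (K q.1 q.2 * F q.1 q.2 ^ 2)
    linear_combination F q.1 q.2 * h

end ConstantCurvature

/-- **Corollary.** If `n ≥ 3`, `F` is a generalized isotropic Berwald metric of scalar
flag curvature and `2μ' - (μ² + 4K)F = 0`, then `K` is constant. -/
theorem gib_scalar_flag_constant_curvature {n : ℕ} (hn : 3 ≤ n) (U : Set (Pt n))
    (F μ lam K : Pt n → Pt n → ℝ) (hF : IsGIB U F μ lam)
    (hK : IsScalarFlagCurv U F K)
    (heq : ∀ x ∈ U, ∀ y : Pt n, y ≠ 0 →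
      2 * (∑ s, hD0 F μ s x y * y s) - ((μ x y) ^ 2 + 4 * K x y) * F x y = 0) :
    ∃ c : ℝ, ∀ x ∈ U, ∀ y : Pt n, y ≠ 0 → K x y = c := by
  have hΩ := hF.finsler.isOpen_slit
  have hv (p) (hp : p ∈ slit U) (v : Pt n) : vD v (Function.uncurry K) p = 0 :=
    hF.vD_flagCurv_eq_zero hK heq hp v
  obtain ⟨c, hc⟩ := hΩ.exists_is_const_of_fderiv_eq_zero hF.finsler.isPreconnected_slit
    (hK.1.differentiableOn (by simp)) fun p hp => ContinuousLinearMap.ext fun w => by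
      have h : fderiv ℝ (Function.uncurry K) p (w.1, 0) + fderiv ℝ (Function.uncurry K) p (0, w.2)
          = 0 := by
        rw [show fderiv ℝ (Function.uncurry K) p (w.1, 0) = 0 from
          hF.finsler.bD_flagCurv_eq_zero hn hK hv hp w.1,
          show fderiv ℝ (Function.uncurry K) p (0, w.2) = 0 from hv p hp w.2, add_zero]
      rw [← map_add] at h
      simpa using h
  exact ⟨c, fun x hx y hy => hc (x, y) ⟨hx, hy⟩⟩
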